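/- Let a, b > 0, 0 ≤ ν ≤ 1 and N ∈ ℕ. Then K( (b/a)^{1/2^{N}}, 2 )^{β_N(ν)} · a^ν b^{1−ν} + S_N(ν; a, b) ≤ ν a + (1−ν) b. -/

import Mathlib

open Real Finset

noncomputable def kj (j : ℕ) (ν : ℝ) : ℤ := ⌊(2:ℝ)^(j-1) * ν⌋

noncomputable def rj (j : ℕ) (ν : ℝ) : ℤ := ⌊(2:ℝ)^j * ν⌋

noncomputable def sj (j : ℕ) (ν : ℝ) : ℝ :=
  (-1:ℝ)^(rj j ν) * (2:ℝ)^(j-1) * ν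
    + (-1:ℝ)^(rj j ν + 1) * (⌊((rj j ν : ℝ) + 1)/2⌋ : ℤ)

noncomputable def SS (N : ℕ) (ν a b : ℝ) : ℝ :=
  ∑ j ∈ Finset.Icc 1 N, sj j ν *
    ((b ^ ((2:ℝ)^(j-1) - (kj j ν : ℝ)) * a ^ ((kj j ν : ℝ))) ^ ((1:ℝ)/2^j)
      - (a ^ ((kj j ν : ℝ) + 1) * b ^ ((2:ℝ)^(j-1) - (kj j ν : ℝ) - 1)) ^ ((1:ℝ)/2^j))^2

noncomputable def Kc (t : ℝ) : ℝ := (t + 1)^2 / (4 * t)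

noncomputable def betaN (N : ℕ) (ν : ℝ) : ℝ :=
  min (1 + (⌊(2:ℝ)^N * ν⌋ : ℝ) - (2:ℝ)^N * ν) ((2:ℝ)^N * ν - (⌊(2:ℝ)^N * ν⌋ : ℝ))

/-- The weighted geometric mean curve. -/
noncomputable def geomCurve (a b x : ℝ) : ℝ := a ^ x * b ^ (1 - x)

/-- The piecewise linear interpolation of `geomCurve a b` on the dyadic mesh of width `2 ^ (-N)`. -/
noncomputable def dyadicInterp (N : ℕ) (ν a b : ℝ) : ℝ :=
  (1 - Int.fract ((2:ℝ)^N * ν)) * geomCurve a b (⌊(2:ℝ)^N * ν⌋ / 2^N)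
    + Int.fract ((2:ℝ)^N * ν) * geomCurve a b ((⌊(2:ℝ)^N * ν⌋ + 1) / 2^N)

theorem geomCurve_exp (α β x : ℝ) :
    geomCurve (exp α) (exp β) x = exp (α * x + β * (1 - x)) := by
  rw [geomCurve, ← exp_mul, ← exp_mul, ← exp_add]

theorem sub_sq_eq_geomCurve {a b m : ℝ} (ha : 0 < a) (hb : 0 < b) (hm : 0 < m) (k : ℝ) :
    ((b ^ (m - k) * a ^ k) ^ (1 / (m * 2)) - (a ^ (k + 1) * b ^ (m - k - 1)) ^ (1 / (m * 2))) ^ 2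
      = geomCurve a b (k / m) + geomCurve a b ((k + 1) / m)
        - 2 * geomCurve a b ((2 * k + 1) / (m * 2)) := by
  obtain ⟨α, rfl⟩ : ∃ α, a = exp α := ⟨log a, (exp_log ha).symm⟩
  obtain ⟨β, rfl⟩ : ∃ β, b = exp β := ⟨log b, (exp_log hb).symm⟩
  simp only [geomCurve_exp, ← exp_mul, ← exp_add]
  rw [sub_sq, mul_assoc 2, ← exp_add, ← exp_nat_mul, ← exp_nat_mul]
  have h₁ : ((2 : ℕ) : ℝ) * ((β * (m - k) + α * k) * (1 / (m * 2)))
      = α * (k / m) + β * (1 - k / m) := by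
    push_cast; field_simp; ring
  have h₂ : ((2 : ℕ) : ℝ) * ((α * (k + 1) + β * (m - k - 1)) * (1 / (m * 2)))
      = α * ((k + 1) / m) + β * (1 - (k + 1) / m) := by
    push_cast; field_simp; ring
  have h₃ : (β * (m - k) + α * k) * (1 / (m * 2))
        + (α * (k + 1) + β * (m - k - 1)) * (1 / (m * 2))
      = α * ((2 * k + 1) / (m * 2)) + β * (1 - (2 * k + 1) / (m * 2)) := by
    field_simp; ring
  rw [h₁, h₂, h₃]
  ring

theorem dyadicInterp_eq_add_succ {a b : ℝ} (ha : 0 < a) (hb : 0 < b) (ν : ℝ) (N : ℕ) :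
    dyadicInterp N ν a b = dyadicInterp (N + 1) ν a b + sj (N + 1) ν *
      ((b ^ ((2:ℝ)^N - (kj (N + 1) ν : ℝ)) * a ^ ((kj (N + 1) ν : ℝ))) ^ ((1:ℝ)/2^(N + 1))
        - (a ^ ((kj (N + 1) ν : ℝ) + 1) * b ^ ((2:ℝ)^N - (kj (N + 1) ν : ℝ) - 1))
          ^ ((1:ℝ)/2^(N + 1)))^2 := by
  have hm : (0:ℝ) < 2 ^ N := by positivity
  simp only [dyadicInterp, sj, rj, kj, Nat.add_sub_cancel, pow_succ (2:ℝ) N]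
  generalize (2:ℝ) ^ N = m at hm ⊢
  rw [sub_sq_eq_geomCurve ha hb hm]
  have hle := Int.floor_le (m * ν)
  have hlt := Int.lt_floor_add_one (m * ν)
  simp only [Int.fract]
  generalize ⌊m * ν⌋ = k at hle hlt ⊢
  have h_mid : ((2 * k + 1 + 1 : ℝ)) / (m * 2) = (k + 1) / m := by
    field_simp; ring
  have h_left : ((2 * k : ℝ)) / (m * 2) = k / m := by
    field_simp
  rcases lt_or_ge (m * ν) (k + 1 / 2) with h | h
  · have hr : ⌊m * 2 * ν⌋ = 2 * k := by
      rw [Int.floor_eq_iff]; push_cast; constructor <;> linarith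
    have hf : ⌊(((2 * k : ℤ) : ℝ) + 1) / 2⌋ = k := by
      rw [Int.floor_eq_iff]; push_cast; constructor <;> linarith
    rw [hr, hf, (even_two_mul k).neg_one_zpow, (even_two_mul k).add_one.neg_one_zpow]
    push_cast
    rw [h_left]
    ring
  · have hr : ⌊m * 2 * ν⌋ = 2 * k + 1 := by
      rw [Int.floor_eq_iff]; push_cast; constructor <;> linarith
    have hf : ⌊(((2 * k + 1 : ℤ) : ℝ) + 1) / 2⌋ = k + 1 := by
      rw [Int.floor_eq_iff]; push_cast; constructor <;> linarith
    rw [hr, hf, (even_two_mul k).add_one.neg_one_zpow,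
      (even_two_mul k).add_one.add_one.neg_one_zpow]
    push_cast
    rw [h_mid]
    ring

theorem dyadicInterp_zero {a b ν : ℝ} (h0 : 0 ≤ ν) (h1 : ν ≤ 1) :
    dyadicInterp 0 ν a b = ν * a + (1 - ν) * b := by
  rcases h1.lt_or_eq with h | rfl
  · have hf : ⌊ν⌋ = 0 := by
      rw [Int.floor_eq_iff]; push_cast; constructor <;> linarith
    simp [dyadicInterp, geomCurve, Int.fract, hf]
    ring
  · simp [dyadicInterp, geomCurve]

theorem dyadicInterp_add_SS {a b ν : ℝ} (ha : 0 < a) (hb : 0 < b) (h0 : 0 ≤ ν) (h1 : ν ≤ 1)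
    (N : ℕ) : dyadicInterp N ν a b + SS N ν a b = ν * a + (1 - ν) * b := by
  induction N with
  | zero => simp [SS, dyadicInterp_zero h0 h1]
  | succ N ih =>
    rw [← ih, dyadicInterp_eq_add_succ ha hb ν N, SS, SS, Finset.sum_Icc_succ_top (by omega),
      Nat.add_sub_cancel]
    ring

theorem Kc_inv (t : ℝ) (ht : 0 < t) : Kc t⁻¹ = Kc t := by
  unfold Kc
  field_simp
  ring

/-- Young's inequality refined by the Kantorovich constant. -/
theorem Kc_rpow_min_mul_rpow_le {t θ : ℝ} (ht : 0 < t) (h0 : 0 ≤ θ) (h1 : θ ≤ 1) :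
    Kc t ^ min (1 - θ) θ * t ^ θ ≤ (1 - θ) + θ * t := by
  have hK : Kc t = ((t + 1) / 2) ^ (2 : ℝ) * t⁻¹ := by
    rw [Kc, rpow_two]; field_simp; ring
  have key (r : ℝ) : Kc t ^ r * t ^ θ = ((t + 1) / 2) ^ (2 * r) * t ^ (θ - r) := by
    rw [hK, mul_rpow (by positivity) (by positivity), ← rpow_mul (by positivity),
      inv_rpow ht.le, rpow_sub ht]
    field_simp
  rw [key]
  rcases le_total θ (1 - θ) with h | h
  · rw [min_eq_right h, sub_self, rpow_zero, mul_one]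
    have := geom_mean_le_arith_mean2_weighted (w₁ := 2 * θ) (w₂ := 1 - 2 * θ)
      (p₁ := (t + 1) / 2) (p₂ := 1) (by linarith) (by linarith) (by positivity) zero_le_one
      (by ring)
    rw [one_rpow, mul_one] at this
    linarith
  · rw [min_eq_left h]
    have := geom_mean_le_arith_mean2_weighted (w₁ := 2 * (1 - θ)) (w₂ := θ - (1 - θ))
      (p₁ := (t + 1) / 2) (p₂ := t) (by linarith) (by linarith) (by positivity) ht.le (by ring)
    linarith

theorem Kc_rpow_mul_le_dyadicInterp {a b : ℝ} (ha : 0 < a) (hb : 0 < b) (ν : ℝ) (N : ℕ) :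
    Kc ((b/a) ^ ((1:ℝ)/2^N)) ^ (betaN N ν) * (a ^ ν * b ^ (1 - ν)) ≤ dyadicInterp N ν a b := by
  have hm : (0:ℝ) < 2 ^ N := by positivity
  have hβ : betaN N ν = min (1 - Int.fract ((2:ℝ)^N * ν)) (Int.fract ((2:ℝ)^N * ν)) := by
    rw [betaN, Int.fract]
    congr 1
    ring
  have hν : ν = (⌊(2:ℝ)^N * ν⌋ + Int.fract ((2:ℝ)^N * ν)) / 2^N := by
    rw [Int.floor_add_fract]; field_simp
  have hK : Kc ((b/a) ^ ((1:ℝ)/2^N)) = Kc ((a/b) ^ ((1:ℝ)/2^N)) := by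
    rw [← Kc_inv _ (by positivity), ← inv_rpow (by positivity), inv_div]
  have h_young := Kc_rpow_min_mul_rpow_le (t := (a/b) ^ ((1:ℝ)/2^N)) (by positivity)
    (Int.fract_nonneg ((2:ℝ)^N * ν)) (Int.fract_lt_one _).le
  have hg : a ^ ν * b ^ (1 - ν) = geomCurve a b ν := rfl
  rw [hβ, hK, dyadicInterp, hg]
  generalize Int.fract ((2:ℝ)^N * ν) = θ at *
  generalize (⌊(2:ℝ)^N * ν⌋ : ℝ) = k at *
  generalize (2:ℝ) ^ N = m at *
  subst hν
  have h_shift (x : ℝ) : geomCurve a b ((k + x) / m)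
      = geomCurve a b (k / m) * ((a / b) ^ (1 / m)) ^ x := by
    obtain ⟨α, rfl⟩ : ∃ α, a = exp α := ⟨log a, (exp_log ha).symm⟩
    obtain ⟨β, rfl⟩ : ∃ β, b = exp β := ⟨log b, (exp_log hb).symm⟩
    rw [geomCurve_exp, geomCurve_exp, ← exp_sub, ← exp_mul, ← exp_mul, ← exp_add]
    congr 1
    field_simp
    ring
  have hpos : 0 < geomCurve a b (k / m) := by unfold geomCurve; positivity
  rw [h_shift, h_shift 1, rpow_one]
  calc _ = geomCurve a b (k / m) * (Kc ((a / b) ^ (1 / m)) ^ min (1 - θ) θ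
        * ((a / b) ^ (1 / m)) ^ θ) := by ring
    _ ≤ geomCurve a b (k / m) * (1 - θ + θ * (a / b) ^ (1 / m)) := by gcongr
    _ = _ := by ring

theorem stmt11 (a b ν : ℝ) (ha : 0 < a) (hb : 0 < b) (h0 : 0 ≤ ν) (h1 : ν ≤ 1) (N : ℕ) :
    Kc ((b/a) ^ ((1:ℝ)/2^N)) ^ (betaN N ν) * (a ^ ν * b ^ (1 - ν)) + SS N ν a b
      ≤ ν * a + (1 - ν) * b := by
  rw [← dyadicInterp_add_SS ha hb h0 h1 N]
  gcongr
  exact Kc_rpow_mul_le_dyadicInterp ha hb ν N
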